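/- Let k : (0,∞) → ℝ be a locally integrable completely monotone (LICM) function, not identically zero, with lim_{t→0⁺} k(t) = ∞. Then k is a Sonine kernel whose Sonine pair consists of two LICM functions: there exists an LICM function l : (0,∞) → ℝ such that (k∗l)(t) = ∫₀ᵗ k(s) l(t−s) ds = 1 for all t > 0. -/

import Mathlib

open MeasureTheory Set Filter Topology

noncomputable section

/-- A real-valued function on `(0,∞)` is completely monotone (CM): infinitely
differentiable on `(0,∞)` with `(-1)^n f⁽ⁿ⁾(t) ≥ 0` for all `t > 0` and `n ∈ ℕ`. -/
def ScalarCM (f : ℝ → ℝ) : Prop :=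
  ContDiffOn ℝ (⊤ : ℕ∞) f (Set.Ioi 0) ∧
  ∀ n : ℕ, ∀ t ∈ Set.Ioi (0:ℝ), 0 ≤ (-1 : ℝ) ^ n * iteratedDeriv n f t

/-- Locally integrable completely monotone (LICM): CM and integrable over `(0,1]`. -/
def ScalarLICM (f : ℝ → ℝ) : Prop :=
  ScalarCM f ∧ MeasureTheory.IntegrableOn f (Set.Ioc 0 1)

/-- A Bernstein function: nonnegative, differentiable on `(0,∞)`, with CM derivative. -/
def ScalarBernstein (f : ℝ → ℝ) : Prop :=
  (∀ t ∈ Set.Ioi (0:ℝ), 0 ≤ f t) ∧ DifferentiableOn ℝ f (Set.Ioi 0) ∧ ScalarCM (deriv f)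

/-- A sequence `g` of functions that are nonnegative on `(0,∞)` and satisfy
`deriv (g n) = -g (n + 1)` there; this encodes that `g 0` is completely monotone, with `g n = (-1)^n (g 0)⁽ⁿ⁾`. -/
structure IsCMTower (g : ℕ → ℝ → ℝ) : Prop where
  nonneg : ∀ n t, 0 < t → 0 ≤ g n t
  hasDerivAt : ∀ n t, 0 < t → HasDerivAt (g n) (-g (n + 1) t) t

theorem isCMTower_sum_exp {κ : Type*} [Fintype κ] (c d : κ → ℝ) (hc : ∀ i, 0 ≤ c i)
    (hd : ∀ i, 0 ≤ d i) :
    IsCMTower fun n t => ∑ i, c i * d i ^ n * Real.exp (-d i * t) where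
  nonneg n t _ := Finset.sum_nonneg fun i _ =>
    mul_nonneg (mul_nonneg (hc i) (pow_nonneg (hd i) n)) (Real.exp_pos _).le
  hasDerivAt n t _ := by
    rw [← Finset.sum_neg_distrib]
    refine HasDerivAt.fun_sum fun i _ => ?_
    have h := (((hasDerivAt_id t).const_mul (-d i)).exp).const_mul (c i * d i ^ n)
    refine h.congr_deriv ?_
    simp only [id, pow_succ]
    ring

/-- The factor `B` of the positive semidefinite generator `Bᵀ B` of the linear system equivalent
to the Volterra equation whose kernel is the exponential sum `∑ i, q i ^ 2 * exp (-r i ^ 2 * t)`. -/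
def volterraFactor {ι : Type*} [DecidableEq ι] (q r : ι → ℝ) : Matrix ι (Option ι) ℝ :=
  fun j p => p.elim (q j) fun i => if i = j then -r j else 0

theorem volterraFactor_gram_mulVec_none {ι : Type*} [Fintype ι] [DecidableEq ι] (q r : ι → ℝ)
    (y : Option ι → ℝ) :
    (((volterraFactor q r).conjTranspose * volterraFactor q r).mulVec y) none =
      (∑ j, q j ^ 2) * y none - ∑ j, q j * r j * y (some j) := by
  rw [← Matrix.mulVec_mulVec]
  simp only [Matrix.mulVec, dotProduct, Fintype.sum_option, Matrix.conjTranspose_apply,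
    volterraFactor, Option.elim, star_trivial, ite_mul, zero_mul, Finset.sum_ite_eq',
    Finset.mem_univ, if_true, Finset.sum_mul, ← Finset.sum_sub_distrib]
  exact Finset.sum_congr rfl fun j _ => by ring

theorem volterraFactor_gram_mulVec_some {ι : Type*} [Fintype ι] [DecidableEq ι] (q r : ι → ℝ)
    (y : Option ι → ℝ) (j : ι) :
    (((volterraFactor q r).conjTranspose * volterraFactor q r).mulVec y) (some j) =
      r j ^ 2 * y (some j) - q j * r j * y none := by
  rw [← Matrix.mulVec_mulVec]
  simp only [Matrix.mulVec, dotProduct, Fintype.sum_option, Matrix.conjTranspose_apply,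
    volterraFactor, Option.elim, star_trivial, ite_mul, zero_mul, Finset.sum_ite_eq',
    Finset.sum_ite_eq, Finset.mem_univ, if_true]
  ring

theorem exists_linear_system_solution {ι : Type*} [Fintype ι] (q r : ι → ℝ) :
    ∃ (a : ℕ → ℝ → ℝ) (y : ι → ℝ → ℝ), IsCMTower a ∧ Continuous (a 0) ∧ a 0 0 = 1 ∧
      (∀ j, y j 0 = 0) ∧
      (∀ t, HasDerivAt (a 0) (-((∑ j, q j ^ 2) * a 0 t - ∑ j, q j * r j * y j t)) t) ∧
      ∀ j t, HasDerivAt (y j) (-(r j ^ 2 * y j t - q j * r j * a 0 t)) t := by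
  classical
  have hpos := Matrix.posSemidef_conjTranspose_mul_self (volterraFactor q r)
  set N := (volterraFactor q r).conjTranspose * volterraFactor q r with hN
  set u := hpos.1.eigenvectorBasis with hu
  set d := hpos.1.eigenvalues with hd
  have hd0 : ∀ i, 0 ≤ d i := hpos.eigenvalues_nonneg
  let Y : Option ι → ℝ → ℝ := fun p t =>
    ∑ i, u i none * Real.exp (-d i * t) * u i p
  have hY0 : ∀ p, Y p 0 = if p = none then 1 else 0 := by
    intro p
    have h := u.sum_inner_mul_inner (EuclideanSpace.single none 1) (EuclideanSpace.single p 1)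
    simp only [EuclideanSpace.inner_single_left, EuclideanSpace.inner_single_right] at h
    simp only [Y, mul_zero, Real.exp_zero, mul_one]
    simpa [eq_comm, Pi.single_apply] using h
  have hYN : ∀ p t, N.mulVec (fun p => Y p t) p =
      ∑ i, u i none * Real.exp (-d i * t) * (d i * u i p) := by
    intro p t
    have h : ∀ i, ∑ p', N p p' * u i p' = d i * u i p := by
      intro i
      have := congrFun (hpos.1.mulVec_eigenvectorBasis i) p
      simpa [Matrix.mulVec, dotProduct] using this
    simp only [Matrix.mulVec, dotProduct, Y, ← h, Finset.mul_sum]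
    rw [Finset.sum_comm]
    exact Finset.sum_congr rfl fun i _ => Finset.sum_congr rfl fun p' _ => by ring
  have hYd : ∀ p t, HasDerivAt (Y p) (-(N.mulVec (fun p => Y p t) p)) t := by
    intro p t
    rw [hYN, ← Finset.sum_neg_distrib]
    refine HasDerivAt.fun_sum fun i _ => ?_
    have h := ((((hasDerivAt_id t).const_mul (-d i)).exp).const_mul (u i none)).mul_const (u i p)
    refine h.congr_deriv ?_
    simp only [id]
    ring
  have ha : (fun t => ∑ i, u i none ^ 2 * d i ^ 0 * Real.exp (-d i * t)) = Y none := by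
    funext t
    exact Finset.sum_congr rfl fun i _ => by ring
  refine ⟨fun n t => ∑ i, u i none ^ 2 * d i ^ n * Real.exp (-d i * t), fun j => Y (some j),
    isCMTower_sum_exp _ _ (fun i => sq_nonneg _) hd0, ?_, ?_, ?_, ?_, ?_⟩
  · fun_prop
  · exact (congrFun ha 0).trans (by simp [hY0])
  · intro j
    simp [hY0]
  · intro t
    have h := hYd none t
    rw [hN, volterraFactor_gram_mulVec_none] at h
    rw [← ha] at h
    exact h
  · intro j t
    have h := hYd (some j) t
    rw [hN, volterraFactor_gram_mulVec_some] at h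
    rw [← ha] at h
    exact h

theorem exists_cmTower_volterra {ι : Type*} [Fintype ι] (w s : ι → ℝ) (hw : ∀ i, 0 ≤ w i)
    (hs : ∀ i, 0 ≤ s i) {ε : ℝ} (hε : 0 < ε) :
    ∃ g : ℕ → ℝ → ℝ, IsCMTower g ∧ Continuous (g 0) ∧
      ∀ t, ε * g 0 t + (∫ τ in (0 : ℝ)..t, (∑ i, w i * Real.exp (-s i * τ)) * g 0 (t - τ)) = 1 := by
  obtain ⟨a, y, ha, hac, ha0, hy0, had, hyd⟩ :=
    exists_linear_system_solution (fun i => √(w i / ε)) (fun i => √(s i))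
  have hq : ∀ i, √(w i / ε) ^ 2 = w i / ε := fun i => Real.sq_sqrt (div_nonneg (hw i) hε.le)
  have hr : ∀ i, √(s i) ^ 2 = s i := fun i => Real.sq_sqrt (hs i)
  simp only [hq, hr] at had hyd
  set b : ι → ℝ := fun i => √(w i / ε) * √(s i) with hb
  have hbb : ∀ i, b i * b i = w i / ε * s i := fun i => by
    simp only [hb]
    rw [mul_mul_mul_comm, Real.mul_self_sqrt (hs i),
      Real.mul_self_sqrt (div_nonneg (hw i) hε.le)]
  let G : ι → ℝ → ℝ := fun i t => ∫ τ in (0 : ℝ)..t, Real.exp (s i * τ) * a 0 τ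
  have hG : ∀ i t, HasDerivAt (G i) (Real.exp (s i * t) * a 0 t) t := by
    intro i t
    have hc : Continuous fun τ => Real.exp (s i * τ) * a 0 τ := by fun_prop
    exact intervalIntegral.integral_hasDerivAt_right (hc.intervalIntegrable _ _)
      (hc.stronglyMeasurableAtFilter _ _) hc.continuousAt
  have hexp : ∀ (c t : ℝ), HasDerivAt (fun t => Real.exp (c * t)) (c * Real.exp (c * t)) t := by
    intro c t
    exact (((hasDerivAt_id t).const_mul c).exp).congr_deriv (by simp only [id]; ring)
  have hyG : ∀ i t, Real.exp (s i * t) * y i t = b i * G i t := by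
    intro i t
    have hd : ∀ t, HasDerivAt (fun t => Real.exp (s i * t) * y i t - b i * G i t) 0 t := by
      intro t
      refine (((hexp (s i) t).mul (hyd i t)).sub ((hG i t).const_mul (b i))).congr_deriv ?_
      simp only [hb]
      ring
    have h := is_const_of_deriv_eq_zero (fun t => (hd t).differentiableAt)
      (fun t => (hd t).deriv) t 0
    simp only [hy0, G, intervalIntegral.integral_same, mul_zero, sub_zero] at h
    exact sub_eq_zero.1 h
  have hyG' : ∀ i t, y i t = b i * (Real.exp (-s i * t) * G i t) := by
    intro i t
    have h1 : Real.exp (-s i * t) * Real.exp (s i * t) = 1 := by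
      rw [← Real.exp_add]; simp
    calc y i t = Real.exp (-s i * t) * Real.exp (s i * t) * y i t := by rw [h1, one_mul]
      _ = Real.exp (-s i * t) * (Real.exp (s i * t) * y i t) := by ring
      _ = _ := by rw [hyG]; ring
  have hsum : ∀ t, a 0 t + ∑ i, w i / ε * (Real.exp (-s i * t) * G i t) = 1 := by
    intro t
    have hd : ∀ t, HasDerivAt
        (fun t => a 0 t + ∑ i, w i / ε * (Real.exp (-s i * t) * G i t)) 0 t := by
      intro t
      refine ((had t).add (HasDerivAt.fun_sum fun i _ =>
        (((hexp (-s i) t).mul (hG i t)).const_mul (w i / ε)))).congr_deriv ?_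
      have h1 : ∀ i, Real.exp (-s i * t) * Real.exp (s i * t) = 1 := by
        intro i
        rw [← Real.exp_add]; simp
      rw [Finset.sum_mul, ← Finset.sum_sub_distrib, ← Finset.sum_neg_distrib,
        ← Finset.sum_add_distrib]
      refine Finset.sum_eq_zero fun i _ => ?_
      rw [hyG']
      linear_combination (Real.exp (-s i * t) * G i t) * hbb i + (w i / ε * a 0 t) * h1 i
    have h := is_const_of_deriv_eq_zero (fun t => (hd t).differentiableAt)
      (fun t => (hd t).deriv) t 0
    simpa [G, ha0] using h
  refine ⟨fun n t => a n t / ε,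
    ⟨fun n t ht => div_nonneg (ha.nonneg n t ht) hε.le, fun n t ht => ?_⟩, hac.div_const ε, fun t => ?_⟩
  · exact ((ha.hasDerivAt n t ht).div_const ε).congr_deriv (by ring)
  · rw [← hsum t]
    congr 1
    · field_simp
    · have h := intervalIntegral.integral_comp_sub_left (a := 0) (b := t)
        (fun τ => (∑ i, w i * Real.exp (-s i * (t - τ))) * (a 0 τ / ε)) t
      simp only [sub_sub_cancel, sub_self, sub_zero] at h
      rw [h]
      have h2 : ∀ τ, (∑ i, w i * Real.exp (-s i * (t - τ))) * (a 0 τ / ε) =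
          ∑ i, w i / ε * (Real.exp (-s i * t) * (Real.exp (s i * τ) * a 0 τ)) := by
        intro τ
        rw [Finset.sum_mul]
        refine Finset.sum_congr rfl fun i _ => ?_
        have : Real.exp (-s i * (t - τ)) = Real.exp (-s i * t) * Real.exp (s i * τ) := by
          rw [← Real.exp_add]; ring_nf
        rw [this]
        ring
      simp only [h2]
      rw [intervalIntegral.integral_finsetSum fun i _ =>
        Continuous.intervalIntegrable (by fun_prop) _ _]
      simp only [intervalIntegral.integral_const_mul, G]

theorem IsCMTower.of_scalarCM {f : ℝ → ℝ} (hf : ScalarCM f) :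
    IsCMTower fun n t => (-1 : ℝ) ^ n * iteratedDeriv n f t where
  nonneg n t ht := hf.2 n t ht
  hasDerivAt n t ht := by
    have hc : ContDiffAt ℝ ((n + 1 : ℕ) : WithTop ℕ∞) f t :=
      (hf.1.contDiffAt (Ioi_mem_nhds ht)).of_le (by exact_mod_cast le_top)
    have hd : DifferentiableAt ℝ (iteratedDeriv n f) t := by
      rw [← differentiableWithinAt_univ, ← iteratedDerivWithin_univ]
      exact hc.contDiffWithinAt.differentiableWithinAt_iteratedDerivWithin
        (by exact_mod_cast Nat.lt_succ_self n) (by simp)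
    refine (hd.hasDerivAt.const_mul ((-1 : ℝ) ^ n)).congr_deriv ?_
    rw [iteratedDeriv_succ, pow_succ]
    ring

namespace IsCMTower

variable {g : ℕ → ℝ → ℝ}

theorem iteratedDeriv_eq (hg : IsCMTower g) (n : ℕ) :
    ∀ t, 0 < t → iteratedDeriv n (g 0) t = (-1 : ℝ) ^ n * g n t := by
  induction n with
  | zero => intro t _; simp
  | succ n ih =>
    intro t ht
    have h : iteratedDeriv n (g 0) =ᶠ[𝓝 t] fun t => (-1 : ℝ) ^ n * g n t := by
      filter_upwards [Ioi_mem_nhds ht] with x hx using ih x hx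
    rw [iteratedDeriv_succ, h.deriv_eq, ((hg.hasDerivAt n t ht).const_mul _).deriv, pow_succ]
    ring

theorem contDiffOn (hg : IsCMTower g) (m : ℕ) : ∀ n, ContDiffOn ℝ m (g n) (Ioi 0) := by
  induction m with
  | zero =>
    intro n
    exact contDiffOn_zero.2 fun t ht => (hg.hasDerivAt n t ht).continuousAt.continuousWithinAt
  | succ m ih =>
    intro n
    have h := (contDiffOn_succ_iff_deriv_of_isOpen (𝕜 := ℝ) (n := m) (f := g n) isOpen_Ioi).2
      ⟨fun t ht => (hg.hasDerivAt n t ht).differentiableAt.differentiableWithinAt,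
        fun h => absurd h (by simp),
        (ih (n + 1)).neg.congr fun t ht => (hg.hasDerivAt n t ht).deriv⟩
    exact_mod_cast h

theorem scalarCM (hg : IsCMTower g) : ScalarCM (g 0) := by
  refine ⟨contDiffOn_infty.2 fun m => hg.contDiffOn m 0, fun n t ht => ?_⟩
  rw [hg.iteratedDeriv_eq n t ht, ← mul_assoc, ← pow_add, ← two_mul, pow_mul]
  simpa using hg.nonneg n t ht

theorem continuousOn (hg : IsCMTower g) (n : ℕ) : ContinuousOn (g n) (Ioi 0) :=
  fun t ht => (hg.hasDerivAt n t ht).continuousAt.continuousWithinAt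

theorem antitoneOn (hg : IsCMTower g) (n : ℕ) : AntitoneOn (g n) (Ioi 0) := by
  refine antitoneOn_of_deriv_nonpos (convex_Ioi 0) (hg.continuousOn n) ?_ ?_
  · rw [interior_Ioi]
    exact fun t ht => (hg.hasDerivAt n t ht).differentiableAt.differentiableWithinAt
  · rw [interior_Ioi]
    intro t ht
    rw [(hg.hasDerivAt n t ht).deriv]
    exact neg_nonpos.2 (hg.nonneg (n + 1) t ht)

theorem sub_translate (hg : IsCMTower g) {h : ℝ} (hh : 0 < h) :
    IsCMTower fun n t => g n t - g n (t + h) where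
  nonneg n t ht := sub_nonneg.2 <|
    hg.antitoneOn n ht (by simp only [mem_Ioi]; positivity) (by linarith)
  hasDerivAt n t ht :=
    ((hg.hasDerivAt n t ht).sub
      ((hg.hasDerivAt n (t + h) (by positivity)).comp_add_const t h)).congr_deriv (by ring)

/-- Mean value estimate for two consecutive derivatives. -/
theorem mul_succ_le (hg : IsCMTower g) (n : ℕ) {t : ℝ} (ht : 0 < t) :
    t / 2 * g (n + 1) t ≤ g n (t / 2) := by
  have hlt : t / 2 < t := by linarith
  obtain ⟨c, hc, hcd⟩ := exists_hasDerivAt_eq_slope (g n) (fun x => -g (n + 1) x) hlt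
    (fun x hx => (hg.hasDerivAt n x (by linarith [hx.1])).continuousAt.continuousWithinAt)
    (fun x hx => hg.hasDerivAt n x (by linarith [hx.1]))
  have h1 : g (n + 1) t ≤ g (n + 1) c :=
    hg.antitoneOn (n + 1) (show 0 < c by linarith [hc.1]) ht hc.2.le
  have h2 : t / 2 * g (n + 1) c = g n (t / 2) - g n t := by
    have : t - t / 2 ≠ 0 := by linarith
    rw [eq_div_iff this] at hcd
    linarith
  have h3 := hg.nonneg n t ht
  nlinarith

/-- Second order Taylor estimate. -/
theorem abs_taylor_le (hg : IsCMTower g) (n : ℕ) {δ t x : ℝ} (hδ : 0 < δ) (ht : δ ≤ t)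
    (hx : δ ≤ x) :
    |g n x - g n t + (x - t) * g (n + 1) t| ≤ g (n + 2) δ * |x - t| ^ 2 := by
  have hpos : ∀ z ∈ uIcc t x, δ ≤ z := fun z hz => (le_inf ht hx).trans hz.1
  have hd1 : ∀ z ∈ uIcc t x, |g (n + 1) z - g (n + 1) t| ≤ g (n + 2) δ * |x - t| := by
    intro z hz
    have h := (convex_uIcc t x).norm_image_sub_le_of_norm_hasDerivWithin_le
      (f := g (n + 1)) (f' := fun y => -g (n + 2) y) (C := g (n + 2) δ)
      (fun y hy => (hg.hasDerivAt (n + 1) y (hδ.trans_le (hpos y hy))).hasDerivWithinAt)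
      (fun y hy => by
        have hy0 := hδ.trans_le (hpos y hy)
        rw [norm_neg, Real.norm_of_nonneg (hg.nonneg _ _ hy0)]
        exact hg.antitoneOn (n + 2) hδ hy0 (hpos y hy)) left_mem_uIcc hz
    refine h.trans (mul_le_mul_of_nonneg_left ?_ (hg.nonneg _ _ hδ))
    exact abs_sub_left_of_mem_uIcc hz
  have h := (convex_uIcc t x).norm_image_sub_le_of_norm_hasDerivWithin_le
      (f := fun y => g n y + y * g (n + 1) t) (f' := fun y => -g (n + 1) y + 1 * g (n + 1) t)
      (C := g (n + 2) δ * |x - t|)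
      (fun y hy => ((hg.hasDerivAt n y (hδ.trans_le (hpos y hy))).add
        ((hasDerivAt_id y).mul_const (g (n + 1) t))).hasDerivWithinAt)
      (fun y hy => by
        have := hd1 y hy
        rw [← abs_neg] at this
        refine le_trans (le_of_eq ?_) this
        rw [Real.norm_eq_abs]
        ring_nf) left_mem_uIcc right_mem_uIcc
  rw [Real.norm_eq_abs, Real.norm_eq_abs] at h
  calc _ = |g n x + x * g (n + 1) t - (g n t + t * g (n + 1) t)| := by ring_nf
    _ ≤ _ := h
    _ = _ := by ring

end IsCMTower

/-- The derivatives of a family of towers are locally bounded as soon as the functions are. -/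
theorem IsCMTower.eventually_le_of_eventually_le {α : Type*} {F : Filter α} {g : α → ℕ → ℝ → ℝ}
    (hg : ∀ m, IsCMTower (g m)) (hb : ∀ t, 0 < t → ∃ C, ∀ᶠ m in F, g m 0 t ≤ C) (n : ℕ) :
    ∀ t, 0 < t → ∃ C, ∀ᶠ m in F, g m n t ≤ C := by
  induction n with
  | zero => exact hb
  | succ n ih =>
    intro t ht
    obtain ⟨C, hC⟩ := ih (t / 2) (by positivity)
    refine ⟨C / (t / 2), hC.mono fun m hm => ?_⟩
    rw [le_div_iff₀ (by positivity), mul_comm]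
    exact ((hg m).mul_succ_le n ht).trans hm

/-- Locally bounded families of towers have limit towers along ultrafilters. -/
theorem IsCMTower.exists_ultrafilter_limit {α : Type*} (U : Ultrafilter α) {g : α → ℕ → ℝ → ℝ}
    (hg : ∀ m, IsCMTower (g m)) (hb : ∀ t, 0 < t → ∃ C, ∀ᶠ m in (U : Filter α), g m 0 t ≤ C) :
    ∃ L : ℕ → ℝ → ℝ, IsCMTower L ∧
      ∀ n t, 0 < t → Tendsto (fun m => g m n t) U (𝓝 (L n t)) := by
  have hlim : ∀ n t, ∃ L, 0 < t → Tendsto (fun m => g m n t) U (𝓝 L) := by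
    intro n t
    by_cases ht : 0 < t
    · obtain ⟨C, hC⟩ := IsCMTower.eventually_le_of_eventually_le hg hb n t ht
      have hmem : ∀ᶠ m in (U : Filter α), g m n t ∈ Icc 0 C :=
        hC.mono fun m hm => ⟨(hg m).nonneg n t ht, hm⟩
      obtain ⟨L, -, hL⟩ := isCompact_Icc.ultrafilter_le_nhds (U.map fun m => g m n t)
        (le_principal_iff.2 hmem)
      exact ⟨L, fun _ => hL⟩
    · exact ⟨0, fun h => absurd h ht⟩
  choose L hL using hlim
  refine ⟨L, ⟨fun n t ht => ge_of_tendsto' (hL n t ht) fun m => (hg m).nonneg n t ht,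
    fun n t ht => ?_⟩, fun n t ht => hL n t ht⟩
  have hδ : 0 < t / 2 := by positivity
  have htaylor : ∀ x, t / 2 ≤ x →
      |L n x - L n t + (x - t) * L (n + 1) t| ≤ L (n + 2) (t / 2) * |x - t| ^ 2 := by
    intro x hx
    have hx0 := hδ.trans_le hx
    refine le_of_tendsto_of_tendsto'
      ((((hL n x hx0).sub (hL n t ht)).add ((hL (n + 1) t ht).const_mul (x - t))).abs)
      ((hL (n + 2) (t / 2) hδ).mul_const _) fun m => ?_
    exact (hg m).abs_taylor_le n hδ (by linarith) hx
  rw [hasDerivAt_iff_isLittleO]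
  have hO : (fun x => L n x - L n t - (x - t) • -L (n + 1) t) =O[𝓝 t]
      fun x => (x - t) ^ 2 := by
    refine Asymptotics.IsBigO.of_bound (L (n + 2) (t / 2)) ?_
    filter_upwards [Ici_mem_nhds (show t / 2 < t by linarith)] with x hx
    have := htaylor x hx
    rw [norm_pow, Real.norm_eq_abs, Real.norm_eq_abs]
    refine le_trans (le_of_eq ?_) this
    rw [smul_eq_mul]
    ring_nf
  refine hO.trans_isLittleO ?_
  have h2 : (fun x : ℝ => (x - t) ^ 2) =o[𝓝 t] fun x => (x - t) ^ 1 :=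
    (Asymptotics.isLittleO_pow_pow (𝕜 := ℝ) (show 1 < 2 by norm_num)).comp_tendsto
      (tendsto_sub_nhds_zero_iff.2 tendsto_id)
  simpa using h2

/-- Translation by `h` on functions. -/
def translateEnd (h : ℝ) : Module.End ℝ (ℝ → ℝ) :=
  LinearMap.funLeft ℝ ℝ fun t => t + h

theorem translateEnd_pow_apply (h : ℝ) (n : ℕ) (f : ℝ → ℝ) (t : ℝ) :
    (translateEnd h ^ n) f t = f (t + n * h) := by
  induction n generalizing t with
  | zero => simp
  | succ n ih =>
    rw [pow_succ', Module.End.mul_apply]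
    change (translateEnd h ^ n) f (t + h) = _
    rw [ih]
    push_cast
    ring_nf

theorem IsCMTower.one_sub_translateEnd_pow_nonneg {g : ℕ → ℝ → ℝ} (hg : IsCMTower g) {h : ℝ}
    (hh : 0 < h) (n : ℕ) {t : ℝ} (ht : 0 < t) : 0 ≤ ((1 - translateEnd h) ^ n) (g 0) t := by
  induction n generalizing g with
  | zero => simpa using hg.nonneg 0 t ht
  | succ n ih =>
    rw [pow_succ, Module.End.mul_apply]
    exact ih (hg.sub_translate hh)

theorem eq_sum_choose_one_sub_translateEnd (h : ℝ) (f : ℝ → ℝ) {n N : ℕ} (hn : n ≤ N) (t : ℝ) :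
    f (t + n * h) = ∑ j ∈ Finset.range (N + 1),
      (N.choose j * ((1 - translateEnd h) ^ (N - j)) f (t + j * h)) *
        (j.choose n / N.choose n) := by
  obtain ⟨M, rfl⟩ := Nat.exists_eq_add_of_le hn
  have hcomm : Commute (translateEnd h) (1 - translateEnd h) :=
    (Commute.one_right _).sub_right (Commute.refl _)
  have h1 := hcomm.add_pow M
  rw [add_sub_cancel, one_pow] at h1
  have h2 : f (t + n * h) = ∑ i ∈ Finset.range (M + 1),
      (M.choose i : ℝ) * ((1 - translateEnd h) ^ (M - i)) f (t + (n + i : ℕ) * h) := by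
    have h3 := congrFun (LinearMap.congr_fun h1 f) (t + n * h)
    rw [Module.End.one_apply] at h3
    rw [h3, LinearMap.sum_apply, Finset.sum_apply]
    refine Finset.sum_congr rfl fun i _ => ?_
    rw [← Nat.cast_comm, Module.End.mul_apply, Module.End.mul_apply,
      Module.End.natCast_apply, Pi.smul_apply, translateEnd_pow_apply, nsmul_eq_mul]
    push_cast
    ring_nf
  have h0 : ∑ j ∈ Finset.range n,
      ((n + M).choose j * ((1 - translateEnd h) ^ (n + M - j)) f (t + j * h)) *
        (j.choose n / (n + M).choose n : ℝ) = 0 :=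
    Finset.sum_eq_zero fun j hj => by
      rw [Nat.choose_eq_zero_of_lt (Finset.mem_range.1 hj)]
      simp
  rw [show n + M + 1 = n + (M + 1) by ring, Finset.sum_range_add, h2, h0, zero_add]
  refine Finset.sum_congr rfl fun i hi => ?_
  have h4 : ((n + M).choose (n + i) : ℝ) * (n + i).choose n = (n + M).choose n * M.choose i := by
    have := Nat.choose_mul (n := n + M) (k := n + i) (s := n) (by omega)
    rw [Nat.add_sub_cancel_left, Nat.add_sub_cancel_left] at this
    exact_mod_cast this
  have h5 : ((n + M).choose n : ℝ) ≠ 0 := by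
    exact_mod_cast (Nat.choose_pos (by omega)).ne'
  rw [show n + M - (n + i) = M - i by omega]
  field_simp
  linear_combination (-((1 - translateEnd h) ^ (M - i)) f (t + (n + i : ℕ) * h)) * h4

theorem abs_pow_sub_choose_div_choose_le {j n N : ℕ} (hj : j ≤ N) (hn : n ≤ N) (hN : 0 < N) :
    |((j : ℝ) / N) ^ n - j.choose n / N.choose n| ≤ n ^ 2 / N := by
  have hN' : (0 : ℝ) < N := by exact_mod_cast hN
  have hjN : (j : ℝ) / N ≤ 1 := (div_le_one hN').2 (by exact_mod_cast hj)
  have hj0 : (0 : ℝ) ≤ (j : ℝ) / N := by positivity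
  induction n with
  | zero => simp
  | succ n ih =>
    have ih := ih (by omega)
    have hNn : (0 : ℝ) < (N : ℝ) - n := by
      have : ((n + 1 : ℕ) : ℝ) ≤ N := by exact_mod_cast hn
      push_cast at this
      linarith
    have hrec : ∀ m : ℕ, n ≤ m →
        ((n : ℝ) + 1) * m.choose (n + 1) = m.choose n * ((m : ℝ) - n) := by
      intro m hm
      have := Nat.choose_succ_right_eq m n
      have h : ((m.choose (n + 1) * (n + 1) : ℕ) : ℝ) = (m.choose n * (m - n) : ℕ) := by
        rw [this]
      push_cast [Nat.cast_sub hm] at h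
      linarith
    have hCN : (0 : ℝ) < N.choose n := by exact_mod_cast Nat.choose_pos (by omega)
    have hCN1 : (0 : ℝ) < N.choose (n + 1) := by exact_mod_cast Nat.choose_pos hn
    rcases lt_or_ge j n with hjn | hjn
    · rw [Nat.choose_eq_zero_of_lt (by omega : j < n + 1)]
      rw [Nat.choose_eq_zero_of_lt hjn] at ih
      simp only [Nat.cast_zero, zero_div, sub_zero] at ih ⊢
      rw [abs_of_nonneg (by positivity)] at ih ⊢
      calc ((j : ℝ) / N) ^ (n + 1) ≤ ((j : ℝ) / N) ^ n := pow_le_pow_of_le_one hj0 hjN (by omega)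
        _ ≤ _ := ih
        _ ≤ _ := by gcongr; linarith
    · set a := ((j : ℝ) / N) ^ n with ha
      set b := (j.choose n : ℝ) / N.choose n with hb
      have hb0 : 0 ≤ b := by positivity
      have hb1 : b ≤ 1 := (div_le_one hCN).2 (by exact_mod_cast Nat.choose_le_choose n hj)
      have hbs : (j.choose (n + 1) : ℝ) / N.choose (n + 1) = b * (((j : ℝ) - n) / (N - n)) := by
        have e1 := hrec j hjn
        have e2 := hrec N (by omega)
        rw [hb, div_mul_div_comm, div_eq_div_iff hCN1.ne' (by positivity), ← e1, ← e2]
        ring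
      have hjn' : (n : ℝ) ≤ j := by exact_mod_cast hjn
      have hjN' : (j : ℝ) ≤ N := by exact_mod_cast hj
      have hd : |(j : ℝ) / N - ((j : ℝ) - n) / (N - n)| ≤ n / N := by
        have : (j : ℝ) / N - ((j : ℝ) - n) / (N - n) = n / N * ((N - j) / (N - n)) := by
          field_simp
          ring
        rw [this, abs_of_nonneg
          (mul_nonneg (by positivity) (div_nonneg (by linarith) hNn.le))]
        exact mul_le_of_le_one_right (by positivity) ((div_le_one hNn).2 (by linarith))
      rw [hbs, pow_succ, ← ha]
      calc |a * (j / N) - b * (((j : ℝ) - n) / (N - n))|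
          = |(a - b) * (j / N) + b * ((j : ℝ) / N - ((j : ℝ) - n) / (N - n))| := by ring_nf
        _ ≤ |a - b| * (j / N) + b * |(j : ℝ) / N - ((j : ℝ) - n) / (N - n)| := by
          refine (abs_add_le _ _).trans (le_of_eq ?_)
          rw [abs_mul, abs_mul, abs_of_nonneg hj0, abs_of_nonneg hb0]
        _ ≤ n ^ 2 / N * 1 + 1 * (n / N) := by gcongr
        _ = (n ^ 2 + n) / N := by ring
        _ ≤ _ := by
          gcongr
          push_cast
          nlinarith [(Nat.cast_nonneg n : (0 : ℝ) ≤ n)]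

/-- Completely monotone functions are approximated by finite sums of decaying exponentials. -/
theorem IsCMTower.exists_sum_exp_approx {g : ℕ → ℝ → ℝ} (hg : IsCMTower g) {h : ℝ} (hh : 0 < h)
    (T : ℝ) {η : ℝ} (hη : 0 < η) :
    ∃ (N : ℕ) (w s : Fin N → ℝ), (∀ i, 0 ≤ w i) ∧ (∀ i, 0 ≤ s i) ∧
      ∀ t, 0 < t → t ≤ T → g 0 (t + 2 * h) - η ≤ ∑ i, w i * Real.exp (-s i * t) ∧
        ∑ i, w i * Real.exp (-s i * t) ≤ g 0 t + η := by
  set K : ℕ := ⌈T / h⌉₊ with hK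
  have hgh : 0 ≤ g 0 h := hg.nonneg 0 h hh
  obtain ⟨N, hN⟩ := exists_nat_gt (g 0 h * K ^ 2 / η + K)
  have hNK : (K : ℝ) < N := lt_of_le_of_lt (le_add_of_nonneg_left (by positivity)) hN
  have hKN : K < N := by exact_mod_cast hNK
  have hN0 : 0 < N := by omega
  have hN0' : (0 : ℝ) < N := by exact_mod_cast hN0
  have hNη : g 0 h * (K ^ 2 / N) ≤ η := by
    have : g 0 h * K ^ 2 / η ≤ N :=
      (le_add_of_nonneg_right (Nat.cast_nonneg K)).trans hN.le
    rw [div_le_iff₀ hη] at this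
    rw [← mul_div_assoc, div_le_iff₀ hN0']
    linarith
  let v : ℕ → ℝ := fun j => N.choose j * ((1 - translateEnd h) ^ (N - j)) (g 0) (h + j * h)
  have hv : ∀ j, 0 ≤ v j := fun j => mul_nonneg (Nat.cast_nonneg _)
    (hg.one_sub_translateEnd_pow_nonneg hh _ (by positivity))
  have hvsum : ∑ j ∈ Finset.range (N + 1), v j = g 0 h := by
    have := eq_sum_choose_one_sub_translateEnd h (g 0) (Nat.zero_le N) h
    simpa using this.symm
  have hmom : ∀ n : ℕ, n ≤ K →
      |(∑ j ∈ Finset.range (N + 1), v j * ((j : ℝ) / N) ^ n) - g 0 (h + n * h)| ≤ η := by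
    intro n hn
    rw [eq_sum_choose_one_sub_translateEnd h (g 0) (hn.trans hKN.le) h,
      ← Finset.sum_sub_distrib]
    refine (Finset.abs_sum_le_sum_abs _ _).trans (le_trans ?_ hNη)
    rw [← hvsum, Finset.sum_mul]
    refine Finset.sum_le_sum fun j hj => ?_
    rw [← mul_sub, abs_mul, abs_of_nonneg (hv j)]
    refine mul_le_mul_of_nonneg_left ?_ (hv j)
    refine (abs_pow_sub_choose_div_choose_le (Nat.lt_succ_iff.1 (Finset.mem_range.1 hj))
      (hn.trans hKN.le) hN0).trans ?_
    gcongr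
  let s : Fin N → ℝ := fun i => -Real.log (((i + 1 : ℕ) : ℝ) / N) / h
  have hs : ∀ i, 0 ≤ s i := fun i => div_nonneg (neg_nonneg.2 (Real.log_nonpos (by positivity)
    ((div_le_one hN0').2 (by exact_mod_cast i.2)))) hh.le
  let e : ℝ → ℝ := fun t => ∑ i : Fin N, v (i + 1) * Real.exp (-s i * t)
  have he : ∀ n : ℕ, e (n * h) = ∑ j ∈ Finset.range N, v (j + 1) * (((j + 1 : ℕ) : ℝ) / N) ^ n := by
    intro n
    rw [← Fin.sum_univ_eq_sum_range (fun j => v (j + 1) * (((j + 1 : ℕ) : ℝ) / N) ^ n) N]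
    refine Finset.sum_congr rfl fun i _ => ?_
    have hx : 0 < (((i + 1 : ℕ) : ℝ) / N) := by positivity
    have : -s i * (n * h) = n * Real.log (((i + 1 : ℕ) : ℝ) / N) := by
      simp only [s]
      field_simp
    rw [this, Real.exp_nat_mul, Real.exp_log hx]
  have hanti : Antitone e := by
    intro x y hxy
    refine Finset.sum_le_sum fun i _ => mul_le_mul_of_nonneg_left ?_ (hv _)
    exact Real.exp_le_exp.2 (mul_le_mul_of_nonpos_left hxy (neg_nonpos.2 (hs i)))
  have hupper : ∀ n : ℕ, n ≤ K → e (n * h) ≤ g 0 (h + n * h) + η := by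
    intro n hn
    have h1 := (abs_le.1 (hmom n hn)).2
    rw [Finset.sum_range_succ', ← he] at h1
    have h2 : 0 ≤ v 0 * (((0 : ℕ) : ℝ) / N) ^ n := mul_nonneg (hv 0) (by positivity)
    linarith
  have hlower : ∀ n : ℕ, n ≠ 0 → n ≤ K → g 0 (h + n * h) - η ≤ e (n * h) := by
    intro n hn0 hn
    have h1 := (abs_le.1 (hmom n hn)).1
    rw [Finset.sum_range_succ', ← he] at h1
    simp only [Nat.cast_zero, zero_div, zero_pow hn0, mul_zero, add_zero] at h1
    linarith
  refine ⟨N, fun i => v (i + 1), s, fun i => hv _, hs, fun t ht htT => ?_⟩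
  have hth : 0 < t / h := by positivity
  have hceilK : ⌈t / h⌉₊ ≤ K := Nat.ceil_mono (by gcongr)
  have hle : t ≤ ⌈t / h⌉₊ * h := (div_le_iff₀ hh).1 (Nat.le_ceil _)
  have hlt : (⌈t / h⌉₊ : ℝ) * h ≤ t + h := by
    have := (Nat.ceil_lt_add_one hth.le).le
    calc (⌈t / h⌉₊ : ℝ) * h ≤ (t / h + 1) * h := by gcongr
      _ = t + h := by field_simp
  have hfl : (⌊t / h⌋₊ : ℝ) * h ≤ t := (le_div_iff₀ hh).1 (Nat.floor_le hth.le)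
  have hfl' : t ≤ h + ⌊t / h⌋₊ * h := by
    have := (Nat.lt_floor_add_one (t / h)).le
    rw [div_le_iff₀ hh] at this
    linarith
  constructor
  · calc g 0 (t + 2 * h) - η ≤ g 0 (h + ⌈t / h⌉₊ * h) - η := by
          gcongr
          exact hg.antitoneOn 0 (show 0 < h + ⌈t / h⌉₊ * h by positivity)
            (show 0 < t + 2 * h by positivity) (by linarith)
      _ ≤ e (⌈t / h⌉₊ * h) := hlower _ (Nat.ceil_pos.2 hth).ne' hceilK
      _ ≤ e t := hanti hle
  · calc e t ≤ e (⌊t / h⌋₊ * h) := hanti hfl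
      _ ≤ g 0 (h + ⌊t / h⌋₊ * h) + η := hupper _ ((Nat.floor_le_ceil _).trans hceilK)
      _ ≤ g 0 t + η := by
          gcongr
          exact hg.antitoneOn 0 ht (show 0 < h + ⌊t / h⌋₊ * h by positivity) hfl'

theorem intervalIntegrable_of_continuousOn_Ioi {f : ℝ → ℝ} (hc : ContinuousOn f (Ioi 0)) {a : ℝ}
    (ha : 0 < a) (hi : IntegrableOn f (Ioc 0 a)) {t : ℝ} (ht : 0 < t) :
    IntervalIntegrable f volume 0 t := by
  have h1 : IntervalIntegrable f volume 0 a :=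
    (intervalIntegrable_iff_integrableOn_Ioc_of_le ha.le).2 hi
  refine h1.trans (hc.mono ?_).intervalIntegrable
  intro x hx
  exact (lt_min ha ht).trans_le hx.1

theorem intervalIntegrable_mul_comp_sub {f g : ℝ → ℝ} (hf : ContinuousOn f (Ioi 0))
    (hg : ContinuousOn g (Ioi 0)) {t : ℝ} (ht : 0 < t)
    (hfi : IntervalIntegrable f volume 0 (t / 2)) (hgi : IntervalIntegrable g volume 0 (t / 2)) :
    IntervalIntegrable (fun s => f s * g (t - s)) volume 0 t := by
  have ht2 : 0 < t / 2 := by positivity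
  have h1 : IntervalIntegrable (fun s => f s * g (t - s)) volume 0 (t / 2) := by
    refine hfi.mul_continuousOn (hg.comp (by fun_prop) fun s hs => ?_)
    rw [uIcc_of_le ht2.le] at hs
    exact show 0 < t - s by linarith [hs.2]
  refine h1.trans ?_
  have h2 : IntervalIntegrable (fun s => g (t - s)) volume (t / 2) t := by
    have := hgi.comp_sub_left t
    simpa [sub_half] using this.symm
  refine h2.continuousOn_mul (hf.mono fun s hs => ?_)
  rw [uIcc_of_le (by linarith)] at hs
  exact ht2.trans_le hs.1

/-- Antitone functions converging at the positive rationals to a continuous function converge on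
the whole half line. -/
theorem tendsto_of_antitoneOn_of_rat {α : Type*} {F : Filter α} {f : α → ℝ → ℝ} {l : ℝ → ℝ}
    (hf : ∀ m, AntitoneOn (f m) (Ioi 0)) (hl : ContinuousOn l (Ioi 0))
    (hq : ∀ q : ℚ, 0 < q → Tendsto (fun m => f m q) F (𝓝 (l q))) {t : ℝ} (ht : 0 < t) :
    Tendsto (fun m => f m t) F (𝓝 (l t)) := by
  have hc := hl.continuousAt (Ioi_mem_nhds ht)
  rw [tendsto_order]
  constructor
  · intro a ha
    obtain ⟨u, hu, hu'⟩ := mem_nhdsGT_iff_exists_Ioo_subset.1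
      (nhdsWithin_le_nhds (hc.eventually (lt_mem_nhds ha)))
    obtain ⟨q, hq1, hq2⟩ := exists_rat_btwn (show t < u from hu)
    have hq0 : (0 : ℝ) < q := ht.trans hq1
    filter_upwards [(hq q (by exact_mod_cast hq0)).eventually (lt_mem_nhds (hu' ⟨hq1, hq2⟩))]
      with m hm
    exact hm.trans_le (hf m ht hq0 hq1.le)
  · intro a ha
    obtain ⟨u, hu, hu'⟩ := mem_nhdsLT_iff_exists_Ioo_subset.1
      (nhdsWithin_le_nhds (hc.eventually (gt_mem_nhds ha)))
    obtain ⟨q, hq1, hq2⟩ := exists_rat_btwn (show max u 0 < t from max_lt hu ht)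
    have hq0 : (0 : ℝ) < q := (le_max_right _ _).trans_lt hq1
    filter_upwards [(hq q (by exact_mod_cast hq0)).eventually
      (gt_mem_nhds (hu' ⟨(le_max_left _ _).trans_lt hq1, hq2⟩))] with m hm
    exact (hf m hq0 ht hq2.le).trans_lt hm

/-- A Sonine-type approximation of a completely monotone function: the `e m` are antitone
kernels approximating `k` and the first entry of the tower `g m` solves the Sonine equation
for `e m` regularized by `1 / (m + 1)` times the identity. -/
structure IsSonineApprox (k : ℝ → ℝ) (e : ℕ → ℝ → ℝ) (g : ℕ → ℕ → ℝ → ℝ) : Prop where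
  continuous_kernel : ∀ m, Continuous (e m)
  antitone_kernel : ∀ m, Antitone (e m)
  kernel_nonneg : ∀ m t, 0 ≤ e m t
  isCMTower : ∀ m, IsCMTower (g m)
  continuous : ∀ m, Continuous (g m 0)
  volterra : ∀ (m : ℕ) (t : ℝ),
    1 / ((m : ℝ) + 1) * g m 0 t + (∫ τ in (0 : ℝ)..t, e m τ * g m 0 (t - τ)) = 1
  le_kernel : ∀ (m : ℕ) (t : ℝ), 0 < t → t ≤ m + 1 →
    k (t + 2 * (1 / ((m : ℝ) + 1))) - 1 / ((m : ℝ) + 1) ≤ e m t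
  kernel_le : ∀ (m : ℕ) (t : ℝ), 0 < t → t ≤ m + 1 → e m t ≤ k t + 1 / ((m : ℝ) + 1)

theorem IsCMTower.exists_isSonineApprox {κ : ℕ → ℝ → ℝ} (hκ : IsCMTower κ) :
    ∃ e g, IsSonineApprox (κ 0) e g := by
  have hm : ∀ m : ℕ, (0 : ℝ) < 1 / ((m : ℝ) + 1) := fun m => by positivity
  choose N w s hw hs he using fun m : ℕ => hκ.exists_sum_exp_approx (hm m) (m + 1) (hm m)
  choose g hg hgc hgv using fun m : ℕ => exists_cmTower_volterra (w m) (s m) (hw m) (hs m) (hm m)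
  refine ⟨fun m t => ∑ i, w m i * Real.exp (-s m i * t), g, ?_, ?_, ?_, hg, hgc, hgv,
    fun m t h0 h1 => (he m t h0 h1).1, fun m t h0 h1 => (he m t h0 h1).2⟩
  · intro m
    fun_prop
  · intro m x y hxy
    refine Finset.sum_le_sum fun i _ => mul_le_mul_of_nonneg_left ?_ (hw m i)
    exact Real.exp_le_exp.2 (mul_le_mul_of_nonpos_left hxy (neg_nonpos.2 (hs m i)))
  · exact fun m t => Finset.sum_nonneg fun i _ => mul_nonneg (hw m i) (Real.exp_pos _).le

namespace IsSonineApprox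

variable {k : ℝ → ℝ} {e : ℕ → ℝ → ℝ} {g : ℕ → ℕ → ℝ → ℝ}

theorem tendsto_kernel (H : IsSonineApprox k e g) (hk : ContinuousOn k (Ioi 0)) {t : ℝ}
    (ht : 0 < t) : Tendsto (fun m => e m t) atTop (𝓝 (k t)) := by
  have h1 : Tendsto (fun m : ℕ => 1 / ((m : ℝ) + 1)) atTop (𝓝 0) :=
    tendsto_one_div_add_atTop_nhds_zero_nat
  have hev : ∀ᶠ m : ℕ in atTop, t ≤ (m : ℝ) + 1 := by
    filter_upwards [eventually_ge_atTop ⌈t⌉₊] with m hm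
    have := (Nat.le_ceil t).trans (show (⌈t⌉₊ : ℝ) ≤ m by exact_mod_cast hm)
    linarith
  have h2 : Tendsto (fun m : ℕ => t + 2 * (1 / ((m : ℝ) + 1))) atTop (𝓝 t) := by
    simpa using (h1.const_mul 2).const_add t
  have h3 := ((hk.continuousAt (Ioi_mem_nhds ht)).tendsto.comp h2).sub h1
  have h4 := h1.const_add (k t)
  rw [sub_zero] at h3
  rw [add_zero] at h4
  exact tendsto_of_tendsto_of_tendsto_of_le_of_le' h3 h4
    (hev.mono fun m hm => H.le_kernel m t ht hm) (hev.mono fun m hm => H.kernel_le m t ht hm)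

theorem nonneg (H : IsSonineApprox k e g) (m : ℕ) {t : ℝ} (ht : 0 ≤ t) : 0 ≤ g m 0 t := by
  rcases ht.eq_or_lt with rfl | ht
  · have h := H.volterra m 0
    rw [intervalIntegral.integral_same, add_zero] at h
    have hm : (0 : ℝ) < 1 / ((m : ℝ) + 1) := by positivity
    by_contra! hneg
    nlinarith
  · exact (H.isCMTower m).nonneg 0 t ht

theorem intervalIntegrable (H : IsSonineApprox k e g) (m : ℕ) (t a b : ℝ) :
    IntervalIntegrable (fun τ => e m τ * g m 0 (t - τ)) volume a b := by
  have := H.continuous_kernel m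
  have := H.continuous m
  exact Continuous.intervalIntegrable (by fun_prop) _ _

theorem kernel_mul_integral_le (H : IsSonineApprox k e g) (m : ℕ) {u : ℝ} (hu : 0 ≤ u) :
    e m u * ∫ τ in (0 : ℝ)..u, g m 0 τ ≤ 1 := by
  have hc := H.continuous m
  have h1 : (∫ τ in (0 : ℝ)..u, g m 0 τ) = ∫ τ in (0 : ℝ)..u, g m 0 (u - τ) := by
    rw [intervalIntegral.integral_comp_sub_left (fun τ => g m 0 τ)]
    simp
  rw [h1, ← intervalIntegral.integral_const_mul]
  have h2 : (∫ τ in (0 : ℝ)..u, e m u * g m 0 (u - τ)) ≤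
      ∫ τ in (0 : ℝ)..u, e m τ * g m 0 (u - τ) := by
    refine intervalIntegral.integral_mono_on hu (Continuous.intervalIntegrable (by fun_prop) _ _)
      (H.intervalIntegrable m u 0 u) fun τ hτ => ?_
    exact mul_le_mul_of_nonneg_right (H.antitone_kernel m hτ.2) (H.nonneg m (by linarith [hτ.2]))
  have h3 := H.volterra m u
  have h4 : 0 ≤ 1 / ((m : ℝ) + 1) * g m 0 u := mul_nonneg (by positivity) (H.nonneg m hu)
  linarith

theorem kernel_mul_le (H : IsSonineApprox k e g) (m : ℕ) {u : ℝ} (hu : 0 < u) :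
    e m u * (u * g m 0 u) ≤ 1 := by
  have hc := H.continuous m
  refine (mul_le_mul_of_nonneg_left ?_ (H.kernel_nonneg m u)).trans
    (H.kernel_mul_integral_le m hu.le)
  have h : (∫ _ in (0 : ℝ)..u, g m 0 u) ≤ ∫ τ in (0 : ℝ)..u, g m 0 τ :=
    intervalIntegral.integral_mono_on_of_le_Ioo hu.le (by simp) (hc.intervalIntegrable _ _)
      fun τ hτ => (H.isCMTower m).antitoneOn 0 hτ.1 hu hτ.2.le
  simpa using h

theorem eventually_le (H : IsSonineApprox k e g) (hk : ContinuousOn k (Ioi 0))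
    (hsing : Tendsto k (𝓝[>] (0 : ℝ)) atTop) {t : ℝ} (ht : 0 < t) :
    ∃ C, ∀ᶠ m in atTop, g m 0 t ≤ C := by
  obtain ⟨s, ⟨hks, hst⟩, hs0 : 0 < s⟩ := ((hsing.eventually_gt_atTop 1).and
    (mem_nhdsWithin_of_mem_nhds (Iio_mem_nhds ht))).and self_mem_nhdsWithin |>.exists
  refine ⟨1 / s, ?_⟩
  filter_upwards [(H.tendsto_kernel hk hs0).eventually (lt_mem_nhds hks)] with m hm
  refine ((H.isCMTower m).antitoneOn 0 hs0 ht (le_of_lt hst)).trans ?_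
  rw [le_div_iff₀ hs0]
  have h1 := H.kernel_mul_le m hs0
  have h2 := mul_nonneg hs0.le (H.nonneg m hs0.le)
  nlinarith

/-- Extraction of a limit of the regularized solutions. -/
theorem exists_limit (H : IsSonineApprox k e g) (hk : ContinuousOn k (Ioi 0))
    (hsing : Tendsto k (𝓝[>] (0 : ℝ)) atTop) :
    ∃ (L : ℕ → ℝ → ℝ) (φ : ℕ → ℕ), IsCMTower L ∧ StrictMono φ ∧
      ∀ t, 0 < t → Tendsto (fun j => g (φ j) 0 t) atTop (𝓝 (L 0 t)) := by
  obtain ⟨L, hL, hlim⟩ := IsCMTower.exists_ultrafilter_limit (hyperfilter ℕ) H.isCMTower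
    fun t ht => (H.eventually_le hk hsing ht).imp fun C hC =>
      Nat.hyperfilter_le_atTop hC
  have hcl : MapClusterPt (fun q : {q : ℚ // 0 < q} => L 0 q) atTop
      fun m (q : {q : ℚ // 0 < q}) => g m 0 q := by
    have h : Tendsto (fun m (q : {q : ℚ // 0 < q}) => g m 0 q) (hyperfilter ℕ)
        (𝓝 fun q : {q : ℚ // 0 < q} => L 0 q) :=
      tendsto_pi_nhds.2 fun q => hlim 0 q (by exact_mod_cast q.2)
    exact h.mapClusterPt.mono Nat.hyperfilter_le_atTop
  obtain ⟨φ, hφ, hφlim⟩ := hcl.tendsto_subseq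
  refine ⟨L, φ, hL, hφ, fun t ht => tendsto_of_antitoneOn_of_rat
    (fun j => (H.isCMTower (φ j)).antitoneOn 0) (hL.continuousOn 0) (fun q hq => ?_) ht⟩
  exact (tendsto_pi_nhds.1 hφlim) ⟨q, hq⟩

theorem integrableOn_limit (H : IsSonineApprox k e g) (hk : ContinuousOn k (Ioi 0))
    {L : ℕ → ℝ → ℝ} {φ : ℕ → ℕ} (hL : IsCMTower L) (hφ : StrictMono φ)
    (hlim : ∀ t, 0 < t → Tendsto (fun j => g (φ j) 0 t) atTop (𝓝 (L 0 t))) {u : ℝ} (hu : 0 < u)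
    (hku : 1 < k u) : IntegrableOn (L 0) (Ioc 0 u) := by
  have hmeas : AEStronglyMeasurable (L 0) (volume.restrict (Ioc 0 u)) :=
    ((hL.continuousOn 0).mono Ioc_subset_Ioi_self).aestronglyMeasurable measurableSet_Ioc
  refine ⟨hmeas, ?_⟩
  have hbound : ∀ᶠ j in atTop, ∫⁻ τ in Ioc 0 u, ‖g (φ j) 0 τ‖ₑ ≤ 1 := by
    filter_upwards [((H.tendsto_kernel hk hu).comp hφ.tendsto_atTop).eventually
      (lt_mem_nhds hku)] with j hj
    have hj : 1 < e (φ j) u := hj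
    have hi : IntegrableOn (g (φ j) 0) (Ioc 0 u) :=
      ((H.continuous (φ j)).integrableOn_Icc).mono_set Ioc_subset_Icc_self
    have hn : 0 ≤ᵐ[volume.restrict (Ioc 0 u)] g (φ j) 0 :=
      (ae_restrict_iff' measurableSet_Ioc).2 (ae_of_all _ fun τ hτ => H.nonneg _ hτ.1.le)
    have h1 := ofReal_integral_eq_lintegral_ofReal hi hn
    have h2 : ∫⁻ τ in Ioc 0 u, ‖g (φ j) 0 τ‖ₑ = ∫⁻ τ in Ioc 0 u, ENNReal.ofReal (g (φ j) 0 τ) :=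
      setLIntegral_congr_fun measurableSet_Ioc fun τ hτ =>
        Real.enorm_of_nonneg (H.nonneg _ hτ.1.le)
    rw [h2, ← h1, ← intervalIntegral.integral_of_le hu.le]
    refine ENNReal.ofReal_le_one.2 ?_
    have h3 := H.kernel_mul_integral_le (φ j) hu.le
    have h4 : 0 ≤ ∫ τ in (0 : ℝ)..u, g (φ j) 0 τ :=
      intervalIntegral.integral_nonneg hu.le fun τ hτ => H.nonneg _ hτ.1
    nlinarith
  have hfatou : ∫⁻ τ in Ioc 0 u, ‖L 0 τ‖ₑ ≤
      liminf (fun j => ∫⁻ τ in Ioc 0 u, ‖g (φ j) 0 τ‖ₑ) atTop := by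
    refine le_trans (le_of_eq ?_) (lintegral_liminf_le fun j =>
      (H.continuous (φ j)).measurable.enorm)
    refine setLIntegral_congr_fun measurableSet_Ioc fun τ hτ => ?_
    exact (((hlim τ hτ.1).enorm).liminf_eq).symm
  refine (hfatou.trans ?_).trans_lt ENNReal.one_lt_top
  exact liminf_le_of_frequently_le' hbound.frequently

theorem integral_limit_mem_Icc (H : IsSonineApprox k e g) (hk : ContinuousOn k (Ioi 0))
    (hsing : Tendsto k (𝓝[>] (0 : ℝ)) atTop) (hki : IntegrableOn k (Ioc 0 1))
    {L : ℕ → ℝ → ℝ} {φ : ℕ → ℕ} (hφ : StrictMono φ)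
    (hlim : ∀ t, 0 < t → Tendsto (fun j => g (φ j) 0 t) atTop (𝓝 (L 0 t))) {t δ : ℝ}
    (hδ : 0 < δ) (hδt : δ < t) (hkδ : 0 < k δ) :
    (∫ s in (0 : ℝ)..(t - δ), k s * L 0 (t - s)) ∈ Icc (1 - k (t - δ) / k δ) 1 := by
  have ht : 0 < t := hδ.trans hδt
  have htδ : 0 < t - δ := sub_pos.2 hδt
  have hek : ∀ s, 0 < s → Tendsto (fun j => e (φ j) s) atTop (𝓝 (k s)) := fun s hs =>
    (H.tendsto_kernel hk hs).comp hφ.tendsto_atTop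
  obtain ⟨C, hC⟩ := H.eventually_le hk hsing hδ
  have hC := hφ.tendsto_atTop.eventually hC
  have hdct : Tendsto (fun j => ∫ s in (0 : ℝ)..(t - δ), e (φ j) s * g (φ j) 0 (t - s)) atTop
      (𝓝 (∫ s in (0 : ℝ)..(t - δ), k s * L 0 (t - s))) := by
    refine intervalIntegral.tendsto_integral_filter_of_dominated_convergence
      (fun s => (k s + 1) * C) ?_ ?_ ?_ ?_
    · refine Eventually.of_forall fun j => ?_
      have := H.continuous_kernel (φ j)
      have := H.continuous (φ j)
      exact Continuous.aestronglyMeasurable (by fun_prop)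
    · filter_upwards [hC, eventually_ge_atTop ⌈t⌉₊] with j hj hjt
      refine ae_of_all _ fun s hs => ?_
      rw [uIoc_of_le htδ.le] at hs
      have hts : 0 < t - s := by linarith [hs.2]
      have hφt : t ≤ (φ j : ℝ) := (Nat.le_ceil t).trans (by exact_mod_cast hjt.trans (hφ.id_le j))
      have h1 := H.kernel_le (φ j) s hs.1 (by linarith [hs.2])
      have h2 : 1 / ((φ j : ℝ) + 1) ≤ 1 := by
        rw [div_le_one (by positivity)]
        linarith [(Nat.cast_nonneg (φ j) : (0 : ℝ) ≤ φ j)]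
      have h3 : g (φ j) 0 (t - s) ≤ C :=
        ((H.isCMTower (φ j)).antitoneOn 0 hδ hts (by linarith [hs.2])).trans hj
      rw [Real.norm_of_nonneg (mul_nonneg (H.kernel_nonneg _ _) (H.nonneg _ hts.le))]
      exact mul_le_mul (by linarith) h3 (H.nonneg _ hts.le)
        ((H.kernel_nonneg (φ j) s).trans (by linarith))
    · exact ((intervalIntegrable_of_continuousOn_Ioi hk one_pos hki htδ).add
        intervalIntegrable_const).mul_const C
    · refine ae_of_all _ fun s hs => ?_
      rw [uIoc_of_le htδ.le] at hs
      exact (hek s hs.1).mul (hlim (t - s) (by linarith [hs.2]))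
  have hε : Tendsto (fun j => 1 / ((φ j : ℝ) + 1) * g (φ j) 0 t) atTop (𝓝 0) := by
    have h1 : Tendsto (fun j => 1 / ((φ j : ℝ) + 1)) atTop (𝓝 0) :=
      tendsto_one_div_add_atTop_nhds_zero_nat.comp hφ.tendsto_atTop
    simpa using h1.mul (hlim t ht)
  have hsplit : ∀ j, (∫ s in (0 : ℝ)..(t - δ), e (φ j) s * g (φ j) 0 (t - s)) +
      (∫ s in (t - δ)..t, e (φ j) s * g (φ j) 0 (t - s)) =
        ∫ s in (0 : ℝ)..t, e (φ j) s * g (φ j) 0 (t - s) := fun j =>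
    intervalIntegral.integral_add_adjacent_intervals (H.intervalIntegrable _ _ _ _)
      (H.intervalIntegrable _ _ _ _)
  constructor
  · have hrhs := (hε.const_sub 1).sub ((hek _ htδ).div (hek δ hδ) hkδ.ne')
    rw [sub_zero] at hrhs
    refine le_of_tendsto_of_tendsto hrhs hdct ?_
    filter_upwards [(hek δ hδ).eventually (lt_mem_nhds hkδ)] with j hj
    have hc := H.continuous (φ j)
    have h1 : (∫ s in (t - δ)..t, e (φ j) s * g (φ j) 0 (t - s)) ≤
        ∫ s in (t - δ)..t, e (φ j) (t - δ) * g (φ j) 0 (t - s) := by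
      refine intervalIntegral.integral_mono_on (by linarith) (H.intervalIntegrable _ _ _ _)
        (Continuous.intervalIntegrable (by fun_prop) _ _) fun s hs => ?_
      exact mul_le_mul_of_nonneg_right (H.antitone_kernel _ hs.1)
        (H.nonneg _ (by linarith [hs.2]))
    rw [intervalIntegral.integral_const_mul,
      intervalIntegral.integral_comp_sub_left (fun s => g (φ j) 0 s), sub_self,
      sub_sub_cancel] at h1
    have h2 : (∫ s in (0 : ℝ)..δ, g (φ j) 0 s) ≤ 1 / e (φ j) δ := by
      rw [le_div_iff₀ hj, mul_comm]
      exact H.kernel_mul_integral_le _ hδ.le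
    have h3 := mul_le_mul_of_nonneg_left h2 (H.kernel_nonneg (φ j) (t - δ))
    rw [mul_one_div] at h3
    have h4 := H.volterra (φ j) t
    have h5 := hsplit j
    show 1 - 1 / ((φ j : ℝ) + 1) * g (φ j) 0 t - e (φ j) (t - δ) / e (φ j) δ ≤ _
    linarith
  · refine le_of_tendsto' hdct fun j => ?_
    have h1 : 0 ≤ ∫ s in (t - δ)..t, e (φ j) s * g (φ j) 0 (t - s) :=
      intervalIntegral.integral_nonneg (by linarith) fun s hs =>
        mul_nonneg (H.kernel_nonneg _ _) (H.nonneg _ (by linarith [hs.2]))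
    have h2 := H.volterra (φ j) t
    have h3 : 0 ≤ 1 / ((φ j : ℝ) + 1) * g (φ j) 0 t :=
      mul_nonneg (by positivity) (H.nonneg _ ht.le)
    have h4 := hsplit j
    linarith

end IsSonineApprox

/-- Every not-identically-zero LICM function `k` with
`lim_{t→0⁺} k(t) = ∞` is a Sonine kernel whose Sonine pair consists of two LICM
functions: there is an LICM function `l` with `(k∗l)(t) = 1` for all `t > 0`. -/
theorem licm_is_sonine_kernel (k : ℝ → ℝ) (hk : ScalarLICM k)
    (hnz : ∃ t ∈ Set.Ioi (0:ℝ), k t ≠ 0)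
    (hsing : Tendsto k (𝓝[>] (0:ℝ)) atTop) :
    ∃ l : ℝ → ℝ, ScalarLICM l ∧
      ∀ t ∈ Set.Ioi (0:ℝ), (∫ s in (0:ℝ)..t, k s * l (t - s)) = 1 := by
  obtain ⟨e, g, H⟩ := (IsCMTower.of_scalarCM hk.1).exists_isSonineApprox
  simp only [pow_zero, one_mul, iteratedDeriv_zero] at H
  have hkc : ContinuousOn k (Ioi 0) := hk.1.1.continuousOn
  obtain ⟨L, φ, hL, hφ, hlim⟩ := H.exists_limit hkc hsing
  obtain ⟨u, hku, hu : 0 < u⟩ :=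
    ((hsing.eventually_gt_atTop 1).and self_mem_nhdsWithin).exists
  have hLc := hL.continuousOn 0
  have hLi : ∀ t, 0 < t → IntervalIntegrable (L 0) volume 0 t := fun t ht =>
    intervalIntegrable_of_continuousOn_Ioi hLc hu
      (H.integrableOn_limit hkc hL hφ hlim hu hku) ht
  refine ⟨L 0, ⟨hL.scalarCM,
    (intervalIntegrable_iff_integrableOn_Ioc_of_le zero_le_one).1 (hLi 1 one_pos)⟩,
    fun t (ht : 0 < t) => ?_⟩
  have hint : IntervalIntegrable (fun s => k s * L 0 (t - s)) volume 0 t :=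
    intervalIntegrable_mul_comp_sub hkc hLc ht
      (intervalIntegrable_of_continuousOn_Ioi hkc one_pos hk.2 (by positivity))
      (hLi _ (by positivity))
  have hsub : Tendsto (fun δ : ℝ => t - δ) (𝓝[>] 0) (𝓝 t) := by
    have : Tendsto (fun δ : ℝ => t - δ) (𝓝 0) (𝓝 (t - 0)) := by
      exact (continuous_const.sub continuous_id).tendsto 0
    rw [sub_zero] at this
    exact this.mono_left nhdsWithin_le_nhds
  have hev : ∀ᶠ δ in 𝓝[>] (0 : ℝ), 0 < δ ∧ δ < t ∧ 0 < k δ := by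
    filter_upwards [self_mem_nhdsWithin, mem_nhdsWithin_of_mem_nhds (Iio_mem_nhds ht),
      hsing.eventually_gt_atTop 0] with δ h1 h2 h3 using ⟨h1, h2, h3⟩
  have hprim : Tendsto (fun δ : ℝ => ∫ s in (0 : ℝ)..(t - δ), k s * L 0 (t - s)) (𝓝[>] 0)
      (𝓝 (∫ s in (0 : ℝ)..t, k s * L 0 (t - s))) := by
    have hcont := intervalIntegral.continuousOn_primitive_interval' hint left_mem_uIcc t
      right_mem_uIcc
    refine hcont.tendsto.comp (tendsto_nhdsWithin_iff.2 ⟨hsub, ?_⟩)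
    filter_upwards [hev] with δ hδ
    rw [uIcc_of_le ht.le]
    exact ⟨by linarith [hδ.2.1], by linarith [hδ.1]⟩
  have hquot : Tendsto (fun δ => 1 - k (t - δ) / k δ) (𝓝[>] 0) (𝓝 1) := by
    have h := ((hkc.continuousAt (Ioi_mem_nhds ht)).tendsto.comp hsub).div_atTop hsing
    simpa using h.const_sub 1
  have hmem : ∀ᶠ δ in 𝓝[>] (0 : ℝ),
      (∫ s in (0 : ℝ)..(t - δ), k s * L 0 (t - s)) ∈ Icc (1 - k (t - δ) / k δ) 1 := by
    filter_upwards [hev] with δ hδ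
    exact H.integral_limit_mem_Icc hkc hsing hk.2 hφ hlim hδ.1 hδ.2.1 hδ.2.2
  exact tendsto_nhds_unique hprim (tendsto_of_tendsto_of_tendsto_of_le_of_le' hquot
    tendsto_const_nhds (hmem.mono fun _ h => h.1) (hmem.mono fun _ h => h.2))
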